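/- arXiv:2409.12461 — 2 statements merged into one kernel-verified Lean document; each statement's English description precedes it below -/
import Mathlib

section
/- Let ψ be a Boolean formula over variables x_1,…,x_n,y_1,…,y_m, let G_ψ be the two-player cycle arena constructed from ψ with players A and E, and let α=(O_A,O_E) where O_A=Muller(¬ψ) and O_E=Muller(ψ) (a zero-sum objective profile). Then the quantified formula ∃y_1…y_m ∀x_1…x_n ψ is true if and only if every profile t∈T_{G_ψ,α,Pos} satisfies out(t)∈Muller(ψ). -/
open scoped Classical

namespace EpistemicRV

/-- Boolean formulas over variables of type `α`. -/
inductive BForm (α : Type) : Type where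
  | tru : BForm α
  | fls : BForm α
  | var : α → BForm α
  | not : BForm α → BForm α
  | and : BForm α → BForm α → BForm α
  | or : BForm α → BForm α → BForm α

/-- Evaluation of a Boolean formula under a truth assignment. -/
def BForm.eval {α : Type} (θ : α → Prop) : BForm α → Prop
  | .tru => True
  | .fls => False
  | .var a => θ a
  | .not f => ¬ (f.eval θ)
  | .and f g => f.eval θ ∧ g.eval θ
  | .or f g => f.eval θ ∨ g.eval θ

/-- Renaming of variables of a Boolean formula. -/
def BForm.map {α β : Type} (h : α → β) : BForm α → BForm β
  | .tru => .tru
  | .fls => .fls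
  | .var a => .var (h a)
  | .not f => .not (f.map h)
  | .and f g => .and (f.map h) (g.map h)
  | .or f g => .or (f.map h) (g.map h)

/-- A game arena: each vertex has an owner, there is an initial vertex and an
edge relation.  (Totality of the edge relation is stated as a separate
hypothesis where needed.) -/
structure Arena (P V : Type) : Type where
  owner : V → P
  v0 : V
  edge : V → V → Prop

/-- A strategy: given the (reversed) past history and the current vertex,
it yields the next vertex.  A history `h v` (ending in the current vertex `v`)
is represented by the pair of the reversed list `h` and `v`. -/
abbrev Strat (V : Type) : Type := List V → V → V

/-- A strategy profile assigns a strategy to every player. -/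
abbrev Profile (P V : Type) : Type := P → Strat V

variable {P V : Type}

/-- A strategy respecting the edge relation. -/
def ValidStrat (A : Arena P V) (s : Strat V) : Prop := ∀ h v, A.edge v (s h v)

/-- A positional strategy only depends on the current vertex. -/
def PositionalStrat (s : Strat V) : Prop := ∀ h h' v, s h v = s h' v

/-- The class Σ of all strategies. -/
def allClass (A : Arena P V) : Set (Strat V) := {s | ValidStrat A s}

/-- The class Pos of positional strategies. -/
def posClass (A : Arena P V) : Set (Strat V) := {s | ValidStrat A s ∧ PositionalStrat s}

/-- Strategy profiles ranging over the class `C` of strategies. -/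
def profiles (A : Arena P V) (C : Set (Strat V)) : Set (Profile P V) :=
  {s | ∀ p, s p ∈ C}

/-- `upd s p t` is the profile `s[p ↦ t]`. -/
noncomputable def upd (s : Profile P V) (p : P) (t : Strat V) : Profile P V :=
  fun q => if q = p then t else s q

/-- The reversed history of length `n+1` generated by the profile `s`. -/
def histOf (A : Arena P V) (s : Profile P V) : ℕ → List V
  | 0 => [A.v0]
  | n + 1 =>
    match histOf A s n with
    | [] => [A.v0]
    | v :: h => s (A.owner v) h v :: v :: h

/-- The outcome play `out(s)` of the profile `s`. -/
def Out (A : Arena P V) (s : Profile P V) : ℕ → V :=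
  fun n => (histOf A s n).getD 0 A.v0

/-- The set of plays of an arena. -/
def plays (A : Arena P V) : Set (ℕ → V) :=
  {ρ | ρ 0 = A.v0 ∧ ∀ i, A.edge (ρ i) (ρ (i + 1))}

/-- `Inf(ρ)`: the set of vertices occurring infinitely often in `ρ`. -/
def InfSet (ρ : ℕ → V) : Set V := {v | ∀ i, ∃ j, i ≤ j ∧ ρ j = v}

/-- The Büchi objective for the set `U` of vertices. -/
def Buchi (U : Set V) : Set (ℕ → V) := {ρ | (InfSet ρ ∩ U).Nonempty}

/-- The Muller objective for a Boolean formula over the vertices. -/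
def Muller (φ : BForm V) : Set (ℕ → V) := {ρ | φ.eval (fun v => v ∈ InfSet ρ)}

/-- `s` is a Nash equilibrium for the objective profile `O` and the class `C`. -/
def NashEq (A : Arena P V) (O : P → Set (ℕ → V)) (C : Set (Strat V))
    (s : Profile P V) : Prop :=
  ∀ p, ∀ t ∈ C, Out A (upd s p t) ∈ O p → Out A s ∈ O p

/-- `t` is a winning strategy of player `p` for objective `Op` over class `C`. -/
def WinningStrat (A : Arena P V) (Op : Set (ℕ → V)) (C : Set (Strat V))
    (p : P) (t : Strat V) : Prop :=
  t ∈ C ∧ ∀ s ∈ profiles A C, Out A (upd s p t) ∈ Op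

/-- Knowledge operator of a single accessibility relation. -/
def Kop {W : Type} (R : W → W → Prop) (E : Set W) : Set W :=
  {w | ∀ w', R w w' → w' ∈ E}

/-- Mutual knowledge operator. -/
def MKop {W : Type} (R : P → W → W → Prop) (E : Set W) : Set W :=
  ⋂ p, Kop (R p) E

/-- Common knowledge operator: `CK(E) = ⋂_{i ≥ 1} MK^i(E)`. -/
def CKop {W : Type} (R : P → W → W → Prop) (E : Set W) : Set W :=
  ⋂ i ∈ Set.Ici (1 : ℕ), (MKop R)^[i] E

/-- Player `p` is rational in world `w` (for arena `A`, objective profile `O`,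
class `C`, accessibility relations `R` and strategy assignment `σ`). -/
def RationalIn (A : Arena P V) (O : P → Set (ℕ → V)) (C : Set (Strat V))
    {W : Type} (R : P → W → W → Prop) (σ : W → Profile P V) (p : P) (w : W) : Prop :=
  ¬ ∃ t ∈ C,
      (∀ w', R p w w' → (Out A (σ w') ∈ O p → Out A (upd (σ w') p t) ∈ O p)) ∧
      (∃ w', R p w w' ∧ Out A (σ w') ∉ O p ∧ Out A (upd (σ w') p t) ∈ O p)

/-- The set of worlds in which every player is rational. -/
def RAT (A : Arena P V) (O : P → Set (ℕ → V)) (C : Set (Strat V))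
    {W : Type} (R : P → W → W → Prop) (σ : W → Profile P V) : Set W :=
  {w | ∀ p, RationalIn A O C R σ p w}

/-- An epistemic model for the arena `A` and the class `C` of strategies. -/
structure EModel {P V : Type} (A : Arena P V) (C : Set (Strat V)) : Type 1 where
  W : Type
  finW : Finite W
  R : P → W → W → Prop
  equivR : ∀ p, Equivalence (R p)
  σ : W → Profile P V
  memC : ∀ w, σ w ∈ profiles A C
  consistent : ∀ p w w', R p w w' → σ w p = σ w' p

/-- The characterization `T_{G,α,S}` of common knowledge of rationality. -/
def Tchar (A : Arena P V) (O : P → Set (ℕ → V)) (C : Set (Strat V)) :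
    Set (Profile P V) :=
  {s | ∃ M : EModel A C, ∃ w : M.W,
        w ∈ CKop M.R (RAT A O C M.R M.σ) ∧ M.σ w = s}

end EpistemicRV

namespace EpistemicRV

/-- Vertices of the two-player cycle arena `G_ψ`: choice vertices `a i` and
literal vertices `x i b` of player `A`, and choice vertices `e j` and literal
vertices `y j b` of player `E` (`b = true` is the positive literal). -/
inductive CycleV (n m : ℕ) : Type where
  | a : Fin n → CycleV n m
  | x : Fin n → Bool → CycleV n m
  | e : Fin m → CycleV n m
  | y : Fin m → Bool → CycleV n m

/-- Edges of the cycle arena: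
`a_i → x_i, x̄_i`, `x_i, x̄_i → a_{i+1}` (or `→ e_1` when `i = n`),
`e_j → y_j, ȳ_j`, `y_j, ȳ_j → e_{j+1}` (or `→ a_1` when `j = m`). -/
def cycleEdge {n m : ℕ} : CycleV n m → CycleV n m → Prop
  | .a i, .x i' _ => i = i'
  | .x i _, .a i' => (i : ℕ) + 1 = (i' : ℕ)
  | .x i _, .e j => (i : ℕ) + 1 = n ∧ (j : ℕ) = 0
  | .e j, .y j' _ => j = j'
  | .y j _, .e j' => (j : ℕ) + 1 = (j' : ℕ)
  | .y j _, .a i' => (j : ℕ) + 1 = m ∧ (i' : ℕ) = 0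
  | _, _ => False

/-- The two-player cycle arena: the player `false` is `A` and owns the `a`/`x`
vertices, the player `true` is `E` and owns the `e`/`y` vertices; the initial
vertex is `a_1`. -/
def cycleArena (n m : ℕ) (hn : 0 < n) : Arena Bool (CycleV n m) where
  owner := fun v =>
    match v with
    | .a _ => false
    | .x _ _ => false
    | .e _ => true
    | .y _ _ => true
  v0 := .a ⟨0, hn⟩
  edge := cycleEdge

/-- The positive literal vertex corresponding to a variable
(`x_i` on the left, `y_j` on the right). -/
def litVertex {n m : ℕ} : Fin n ⊕ Fin m → CycleV n m :=
  Sum.elim (fun i => .x i true) (fun j => .y j true)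

/-- The truth assignment `θ_s` corresponding to a positional profile `s`:
a variable is true iff its positive literal vertex is chosen. -/
def thetaOf {n m : ℕ} (s : Profile Bool (CycleV n m)) : Fin n ⊕ Fin m → Prop
  | .inl i => s false [] (.a i) = CycleV.x i true
  | .inr j => s true [] (.e j) = CycleV.y j true

end EpistemicRV

namespace EpistemicRV

section Formulas

theorem BForm.eval_map {α β : Type} (h : α → β) (θ : β → Prop) (φ : BForm α) :
    (φ.map h).eval θ ↔ φ.eval (θ ∘ h) := by
  induction φ <;> simp_all [BForm.map, BForm.eval]

end Formulas

section Plays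

variable {P V : Type}

theorem histOf_eq_out_cons (A : Arena P V) (s : Profile P V) (k : ℕ) :
    ∃ h, histOf A s k = Out A s k :: h := by
  have hne : histOf A s k ≠ [] := by
    cases k with
    | zero => simp [histOf]
    | succ k => rw [histOf]; split <;> simp
  obtain ⟨v, h, hv⟩ := List.exists_cons_of_ne_nil hne
  exact ⟨h, by simp [Out, hv]⟩

/-- A positional profile produces a play by iterating its successor function. -/
theorem out_succ {A : Arena P V} {s : Profile P V} (hs : ∀ p, PositionalStrat (s p)) (k : ℕ) :
    Out A s (k + 1) = s (A.owner (Out A s k)) [] (Out A s k) := by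
  obtain ⟨h, hk⟩ := histOf_eq_out_cons A s k
  rw [← hs _ h [] (Out A s k), Out]
  simp [histOf, hk]

theorem out_edge {A : Arena P V} {s : Profile P V} (hv : ∀ p, ValidStrat A (s p))
    (hs : ∀ p, PositionalStrat (s p)) (k : ℕ) : A.edge (Out A s k) (Out A s (k + 1)) := by
  rw [out_succ hs]
  exact hv _ _ _

theorem upd_mem_profiles {A : Arena P V} {C : Set (Strat V)} {s : Profile P V}
    (hs : s ∈ profiles A C) (p : P) {t : Strat V} (ht : t ∈ C) : upd s p t ∈ profiles A C := by
  intro q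
  by_cases h : q = p
  · simpa [upd, h] using ht
  · simpa [upd, h] using hs q

end Plays

section Knowledge

variable {P W : Type}

theorem CKop_subset [Nonempty P] {R : P → W → W → Prop} (hR : ∀ p w, R p w w) (E : Set W) :
    CKop R E ⊆ E := by
  intro w hw
  have h : w ∈ MKop R E := by simpa using Set.mem_iInter₂.1 hw 1 (Set.mem_Ici.2 le_rfl)
  exact Set.mem_iInter.1 h (Classical.arbitrary P) w (hR _ w)

theorem CKop_univ (R : P → W → W → Prop) : CKop R (Set.univ : Set W) = Set.univ := by
  have h : MKop R (Set.univ : Set W) = Set.univ := by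
    ext w; simp [MKop, Kop]
  simp [CKop, Function.iterate_fixed h]

end Knowledge

section Dominance

/-- Every row is matched against `T` by a row of `S`, and every column against `S` by a column
of `T`. -/
def Covers {α β : Type} (L : α → β → Prop) (q : Set α × Set β) : Prop :=
  (∀ a', ∃ a ∈ q.1, ∀ b ∈ q.2, L a' b → L a b) ∧
    (∀ b', ∃ b ∈ q.2, ∀ a ∈ q.1, L a b → L a b')

/-- Outcome of iterated elimination of weakly dominated strategies in a finite win-lose game. -/
theorem exists_undominated {α β : Type} [Finite α] [Finite β] (L : α → β → Prop) :
    ∃ (S : Set α) (T : Set β), Covers L (S, T) ∧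
      (∀ a ∈ S, ∀ a', (∀ b ∈ T, L a b → L a' b) → ∀ b ∈ T, L a' b → L a b) ∧
      (∀ b ∈ T, ∀ b', (∀ a ∈ S, L a b' → L a b) → ∀ a ∈ S, L a b → L a b') := by
  have huniv : Covers L (Set.univ, Set.univ) :=
    ⟨fun a => ⟨a, trivial, fun _ _ h => h⟩, fun b => ⟨b, trivial, fun _ _ h => h⟩⟩
  obtain ⟨⟨S, T⟩, hmin⟩ := (Set.toFinite {q | Covers L q}).exists_minimal ⟨_, huniv⟩
  have hcov : Covers L (S, T) := hmin.prop
  refine ⟨S, T, hcov, ?_, ?_⟩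
  · intro a ha a' hdom b hb hlt
    by_contra hnot
    obtain ⟨c, hc, hc'⟩ := hcov.1 a'
    have hca : c ≠ a := by rintro rfl; exact hnot (hc' b hb hlt)
    have hsmall : Covers L (S \ {a}, T) := by
      refine ⟨fun d' => ?_, fun b' => ?_⟩
      · obtain ⟨d, hd, hd'⟩ := hcov.1 d'
        by_cases hda : d = a
        · subst hda
          exact ⟨c, ⟨hc, hca⟩, fun b hb h => hc' b hb (hdom b hb (hd' b hb h))⟩
        · exact ⟨d, ⟨hd, hda⟩, hd'⟩
      · obtain ⟨d, hd, hd'⟩ := hcov.2 b'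
        exact ⟨d, hd, fun e he => hd' e he.1⟩
    have hle := hmin.le_of_le hsmall ⟨Set.sdiff_subset, le_rfl⟩
    exact (hle.1 ha).2 rfl
  · intro b hb b' hdom a ha hlt
    by_contra hnot
    obtain ⟨c, hc, hc'⟩ := hcov.2 b'
    have hcb : c ≠ b := by rintro rfl; exact hnot (hc' a ha hlt)
    have hsmall : Covers L (S, T \ {b}) := by
      refine ⟨fun a' => ?_, fun d' => ?_⟩
      · obtain ⟨d, hd, hd'⟩ := hcov.1 a'
        exact ⟨d, hd, fun e he => hd' e he.1⟩
      · obtain ⟨d, hd, hd'⟩ := hcov.2 d'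
        by_cases hdb : d = b
        · subst hdb
          exact ⟨c, ⟨hc, hcb⟩, fun a ha h => hd' a ha (hdom a ha (hc' a ha h))⟩
        · exact ⟨d, ⟨hd, hdb⟩, hd'⟩
    have hle := hmin.le_of_le hsmall ⟨le_rfl, Set.sdiff_subset⟩
    exact (hle.2 hb).2 rfl

end Dominance

section CycleArena

variable {n m : ℕ}

/-- Position of a vertex along the cycle. -/
def CycleV.pos : CycleV n m → ℕ
  | .a i => 2 * i
  | .x i _ => 2 * i + 1
  | .e j => 2 * n + 2 * j
  | .y j _ => 2 * n + 2 * j + 1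

theorem CycleV.pos_lt (v : CycleV n m) : v.pos < 2 * n + 2 * m := by
  cases v <;> simp only [CycleV.pos] <;> omega

theorem CycleV.eq_a_of_pos {v : CycleV n m} {i : Fin n} (h : v.pos = (CycleV.a i : CycleV n m).pos) :
    v = .a i := by
  cases v <;> simp only [CycleV.pos, CycleV.a.injEq, Fin.ext_iff, reduceCtorEq] at * <;> omega

theorem CycleV.eq_e_of_pos {v : CycleV n m} {j : Fin m} (h : v.pos = (CycleV.e j : CycleV n m).pos) :
    v = .e j := by
  cases v <;> simp only [CycleV.pos, CycleV.e.injEq, Fin.ext_iff, reduceCtorEq] at * <;> omega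

theorem cycleEdge.pos_modEq {u v : CycleV n m} (h : cycleEdge u v) :
    v.pos ≡ u.pos + 1 [MOD 2 * n + 2 * m] := by
  have key : v.pos = u.pos + 1 ∨ (u.pos + 1 = 2 * n + 2 * m ∧ v.pos = 0) := by
    cases u <;> cases v <;> simp only [cycleEdge, CycleV.pos] at * <;> omega
  rcases key with h | ⟨h, h'⟩
  · rw [h]
  · rw [h, h']; simp [Nat.ModEq]

variable {hn : 0 < n} {s : Profile Bool (CycleV n m)}

theorem pos_out_modEq (hs : s ∈ profiles (cycleArena n m hn) (posClass (cycleArena n m hn)))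
    (k : ℕ) : (Out (cycleArena n m hn) s k).pos ≡ k [MOD 2 * n + 2 * m] := by
  induction k with
  | zero => rfl
  | succ k ih =>
    have h := out_edge (fun p => (hs p).1) (fun p => (hs p).2) k
    exact (cycleEdge.pos_modEq h).trans (ih.add_right 1)

theorem pos_out_add_mul
    (hs : s ∈ profiles (cycleArena n m hn) (posClass (cycleArena n m hn)))
    (v : CycleV n m) (k : ℕ) :
    (Out (cycleArena n m hn) s (v.pos + (2 * n + 2 * m) * k)).pos = v.pos := by
  refine Nat.ModEq.eq_of_lt_of_lt ((pos_out_modEq hs _).trans ?_) (CycleV.pos_lt _)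
    (CycleV.pos_lt _)
  simp [Nat.ModEq]

theorem succ_mem_infSet (hs : s ∈ profiles (cycleArena n m hn) (posClass (cycleArena n m hn)))
    {u : CycleV n m} (hu : ∀ v : CycleV n m, v.pos = u.pos → v = u) :
    s ((cycleArena n m hn).owner u) [] u ∈ InfSet (Out (cycleArena n m hn) s) := by
  intro i
  refine ⟨u.pos + (2 * n + 2 * m) * i + 1, ?_, ?_⟩
  · have : 1 * i ≤ (2 * n + 2 * m) * i := Nat.mul_le_mul_right i (by omega)
    omega
  · rw [out_succ (fun p => (hs p).2), hu _ (pos_out_add_mul hs u i)]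

theorem exists_pred_of_mem_infSet
    (hs : s ∈ profiles (cycleArena n m hn) (posClass (cycleArena n m hn)))
    {v : CycleV n m} (hv : v ∈ InfSet (Out (cycleArena n m hn) s)) :
    ∃ u, cycleEdge u v ∧ s ((cycleArena n m hn).owner u) [] u = v := by
  obtain ⟨j, hj, rfl⟩ := hv 1
  obtain ⟨k, rfl⟩ := Nat.exists_eq_add_of_le' hj
  exact ⟨_, out_edge (fun p => (hs p).1) (fun p => (hs p).2) k,
    (out_succ (fun p => (hs p).2) k).symm⟩

theorem litVertex_mem_infSet_iff
    (hs : s ∈ profiles (cycleArena n m hn) (posClass (cycleArena n m hn)))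
    (z : Fin n ⊕ Fin m) :
    litVertex z ∈ InfSet (Out (cycleArena n m hn) s) ↔ thetaOf s z := by
  rcases z with i | j
  · constructor
    · intro h
      obtain ⟨u, hu, hsu⟩ := exists_pred_of_mem_infSet hs h
      cases u <;> simp only [cycleEdge, litVertex, Sum.elim_inl] at hu
      subst hu
      exact hsu
    · intro h
      have := succ_mem_infSet hs (u := .a i) fun _ => CycleV.eq_a_of_pos
      rwa [show s ((cycleArena n m hn).owner (.a i)) [] (.a i) = .x i true from h] at this
  · constructor
    · intro h
      obtain ⟨u, hu, hsu⟩ := exists_pred_of_mem_infSet hs h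
      cases u <;> simp only [cycleEdge, litVertex, Sum.elim_inr] at hu
      subst hu
      exact hsu
    · intro h
      have := succ_mem_infSet hs (u := .e j) fun _ => CycleV.eq_e_of_pos
      rwa [show s ((cycleArena n m hn).owner (.e j)) [] (.e j) = .y j true from h] at this

theorem out_mem_muller_iff
    (hs : s ∈ profiles (cycleArena n m hn) (posClass (cycleArena n m hn)))
    (φ : BForm (Fin n ⊕ Fin m)) :
    Out (cycleArena n m hn) s ∈ Muller (φ.map litVertex) ↔ φ.eval (thetaOf s) := by
  have h : (fun v => v ∈ InfSet (Out (cycleArena n m hn) s)) ∘ litVertex = thetaOf s :=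
    funext fun z => propext (litVertex_mem_infSet_iff hs z)
  rw [← h]
  exact BForm.eval_map _ _ _

/-- The assignment to the `x` variables chosen by a strategy of `A`. -/
def choiceA (t : Strat (CycleV n m)) (i : Fin n) : Prop := t [] (.a i) = .x i true

/-- The assignment to the `y` variables chosen by a strategy of `E`. -/
def choiceE (t : Strat (CycleV n m)) (j : Fin m) : Prop := t [] (.e j) = .y j true

theorem thetaOf_eq (s : Profile Bool (CycleV n m)) :
    thetaOf s = Sum.elim (choiceA (s false)) (choiceE (s true)) := by
  funext z
  cases z <;> rfl

/-- The positional strategy choosing literals according to `f` and `g`. -/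
noncomputable def literalStrat (hn : 0 < n) (hm : 0 < m) (f : Fin n → Prop) (g : Fin m → Prop) :
    Strat (CycleV n m) :=
  fun _ v =>
    match v with
    | .a i => .x i (decide (f i))
    | .x i _ => if h : (i : ℕ) + 1 < n then .a ⟨i + 1, h⟩ else .e ⟨0, hm⟩
    | .e j => .y j (decide (g j))
    | .y j _ => if h : (j : ℕ) + 1 < m then .e ⟨j + 1, h⟩ else .a ⟨0, hn⟩

theorem literalStrat_mem (hn : 0 < n) (hm : 0 < m) (f : Fin n → Prop) (g : Fin m → Prop) :
    literalStrat hn hm f g ∈ posClass (cycleArena n m hn) := by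
  refine ⟨fun h v => ?_, fun _ _ _ => rfl⟩
  rcases v with i | ⟨i, b⟩ | j | ⟨j, b⟩
  · simp [literalStrat, cycleArena, cycleEdge]
  · by_cases hi : (i : ℕ) + 1 < n
    · simp [literalStrat, cycleArena, cycleEdge, hi]
    · simp only [literalStrat, cycleArena, hi, dite_false]
      exact ⟨by omega, rfl⟩
  · simp [literalStrat, cycleArena, cycleEdge]
  · by_cases hj : (j : ℕ) + 1 < m
    · simp [literalStrat, cycleArena, cycleEdge, hj]
    · simp only [literalStrat, cycleArena, hj, dite_false]
      exact ⟨by omega, rfl⟩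

@[simp]
theorem choiceA_literalStrat (hn : 0 < n) (hm : 0 < m) (f : Fin n → Prop) (g : Fin m → Prop) :
    choiceA (literalStrat hn hm f g) = f := by
  funext i
  simp [choiceA, literalStrat]

@[simp]
theorem choiceE_literalStrat (hn : 0 < n) (hm : 0 < m) (f : Fin n → Prop) (g : Fin m → Prop) :
    choiceE (literalStrat hn hm f g) = g := by
  funext j
  simp [choiceE, literalStrat]

/-- The epistemic model whose worlds are the pairs in `S ×ˢ T`, each player knowing exactly
their own strategy. -/
noncomputable def productModel (hn : 0 < n) (hm : 0 < m)
    (S : Set (Fin n → Prop)) (T : Set (Fin m → Prop)) :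
    EModel (cycleArena n m hn) (posClass (cycleArena n m hn)) where
  W := S × T
  finW := inferInstance
  R := fun p w w' => cond p (w.2 = w'.2) (w.1 = w'.1)
  equivR := by
    rintro (_ | _)
    · exact ⟨fun _ => rfl, Eq.symm, Eq.trans⟩
    · exact ⟨fun _ => rfl, Eq.symm, Eq.trans⟩
  σ := fun w p =>
    cond p (literalStrat hn hm (fun _ => True) w.2) (literalStrat hn hm w.1 (fun _ => True))
  memC := by
    rintro w (_ | _) <;> exact literalStrat_mem hn hm _ _
  consistent := by
    rintro (_ | _) w w' h
    · exact congrArg (fun f : S => literalStrat hn hm f (fun _ => True)) h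
    · exact congrArg (fun g : T => literalStrat hn hm (fun _ => True) g) h

theorem choiceA_productModel (hn : 0 < n) (hm : 0 < m) (S : Set (Fin n → Prop))
    (T : Set (Fin m → Prop)) (w : S × T) :
    choiceA ((productModel hn hm S T).σ w false) = w.1 :=
  choiceA_literalStrat hn hm _ _

theorem choiceE_productModel (hn : 0 < n) (hm : 0 < m) (S : Set (Fin n → Prop))
    (T : Set (Fin m → Prop)) (w : S × T) :
    choiceE ((productModel hn hm S T).σ w true) = w.2 :=
  choiceE_literalStrat hn hm _ _

end CycleArena

/-- with the zero-sum objective profile `O_A = Muller(¬ψ)`,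
`O_E = Muller(ψ)`, the formula `∃y ∀x ψ` is true iff every profile in
`T_{G_ψ,α,Pos}` satisfies `out(t) ∈ Muller(ψ)`. -/
theorem exists_forall_iff_Tchar (n m : ℕ) (hn : 0 < n) (hm : 0 < m)
    (ψ : BForm (Fin n ⊕ Fin m)) :
    (∃ g : Fin m → Prop, ∀ f : Fin n → Prop, ψ.eval (Sum.elim f g)) ↔
      (∀ t ∈ Tchar (cycleArena n m hn)
          (fun p =>
            cond p (Muller (ψ.map litVertex))
              (Muller ((BForm.not ψ).map litVertex)))
          (posClass (cycleArena n m hn)),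
        Out (cycleArena n m hn) t ∈ Muller (ψ.map litVertex)) := by
  constructor
  · rintro ⟨g, hg⟩ t ⟨M, w, hw, rfl⟩
    by_contra hlose
    have hrat := CKop_subset (fun p => (M.equivR p).refl) _ hw true
    have hmem := literalStrat_mem hn hm (fun _ => True) g
    have hwin : ∀ w', Out (cycleArena n m hn)
        (upd (M.σ w') true (literalStrat hn hm (fun _ => True) g)) ∈
          Muller (ψ.map litVertex) := fun w' => by
      rw [out_mem_muller_iff (upd_mem_profiles (M.memC w') true hmem), thetaOf_eq]
      simpa [upd] using hg _
    exact hrat ⟨_, hmem, fun w' _ _ => hwin w', w, (M.equivR true).refl w, hlose, hwin w⟩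
  · intro hT
    by_contra! hcon
    obtain ⟨S, T, hcov, hA, hE⟩ :=
      exists_undominated fun (f : Fin n → Prop) (g : Fin m → Prop) => ¬ ψ.eval (Sum.elim f g)
    obtain ⟨g, hg, -⟩ := hcov.2 fun _ => True
    obtain ⟨f', hf'⟩ := hcon g
    obtain ⟨f, hf, hff'⟩ := hcov.1 f'
    let M := productModel hn hm S T
    have hM₁ : ∀ w : S × T, choiceA (M.σ w false) = w.1 := choiceA_productModel hn hm S T
    have hM₂ : ∀ w : S × T, choiceE (M.σ w true) = w.2 := choiceE_productModel hn hm S T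
    have hout : ∀ (φ : BForm (Fin n ⊕ Fin m)) (w : S × T),
        Out (cycleArena n m hn) (M.σ w) ∈ Muller (φ.map litVertex) ↔
          φ.eval (Sum.elim (w.1 : Fin n → Prop) w.2) := fun φ w => by
      rw [out_mem_muller_iff (M.memC w), thetaOf_eq, hM₁, hM₂]
    have houtA : ∀ (φ : BForm (Fin n ⊕ Fin m)) (w : S × T),
        ∀ t ∈ posClass (cycleArena n m hn),
        (Out (cycleArena n m hn) (upd (M.σ w) false t) ∈ Muller (φ.map litVertex) ↔
          φ.eval (Sum.elim (choiceA t) w.2)) := fun φ w t ht => by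
      rw [out_mem_muller_iff (upd_mem_profiles (M.memC w) false ht), thetaOf_eq, ← hM₂]
      simp [upd]
    have houtE : ∀ (φ : BForm (Fin n ⊕ Fin m)) (w : S × T),
        ∀ t ∈ posClass (cycleArena n m hn),
        (Out (cycleArena n m hn) (upd (M.σ w) true t) ∈ Muller (φ.map litVertex) ↔
          φ.eval (Sum.elim (w.1 : Fin n → Prop) (choiceE t))) := fun φ w t ht => by
      rw [out_mem_muller_iff (upd_mem_profiles (M.memC w) true ht), thetaOf_eq, ← hM₁]
      simp [upd]
    have hrat : RAT (cycleArena n m hn)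
        (fun p => cond p (Muller (ψ.map litVertex)) (Muller ((BForm.not ψ).map litVertex)))
        (posClass (cycleArena n m hn)) M.R M.σ = Set.univ := by
      refine Set.eq_univ_of_forall ?_
      rintro ⟨⟨f, hf⟩, ⟨g, hg⟩⟩ (_ | _) ⟨t, ht, hle, ⟨⟨f₁, hf₁⟩, ⟨g₁, hg₁⟩⟩, hR, hlose, hwin⟩
      · obtain rfl : f = f₁ := congrArg Subtype.val hR
        refine hlose ((hout _ _).2 (hA f hf (choiceA t) ?_ g₁ hg₁ ((houtA _ _ t ht).1 hwin)))
        intro b hb h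
        exact (houtA _ _ t ht).1 (hle (⟨f, hf⟩, ⟨b, hb⟩) rfl ((hout _ _).2 h))
      · obtain rfl : g = g₁ := congrArg Subtype.val hR
        refine hE g hg (choiceE t) ?_ f₁ hf₁ (fun h => hlose ((hout _ _).2 h))
          ((houtE _ _ t ht).1 hwin)
        intro a ha h h'
        exact h ((houtE _ _ t ht).1 (hle (⟨a, ha⟩, ⟨g, hg⟩) rfl ((hout _ _).2 h')))
    have hmem := hT (M.σ (⟨f, hf⟩, ⟨g, hg⟩)) ⟨M, (⟨f, hf⟩, ⟨g, hg⟩), by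
      rw [hrat, CKop_univ]; trivial, rfl⟩
    exact hff' g hg hf' ((hout _ _).1 hmem)

end EpistemicRV
end

section
/- Let G be a two-player game arena with players A and E and let α=(O_A,O_E) be a zero-sum objective profile. If neither A nor E has a winning strategy over positional strategy profiles, then there exists a profile s∈T_{G,α,Pos} with out(s)∉O_E (equivalently, out(s)∈O_A). -/
open scoped Classical

namespace EpistemicRV

lemma upd_same {P V : Type} (s : Profile P V) (p : P) (t : Strat V) : upd s p t p = t := by
  simp [upd]

lemma upd_ne {P V : Type} (s : Profile P V) {p q : P} (t : Strat V) (h : q ≠ p) :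
    upd s p t q = s q := by
  simp [upd, h]

lemma upd_upd {P V : Type} (s : Profile P V) (p : P) (t u : Strat V) :
    upd (upd s p t) p u = upd s p u := by
  funext q
  by_cases h : q = p <;> simp [upd, h]

lemma upd_self {P V : Type} (s : Profile P V) (p : P) : upd s p (s p) = s := by
  funext q
  by_cases h : q = p <;> simp [upd, h]

lemma upd_mem {P V : Type} {D : P → Set (Strat V)} {s : Profile P V} {p : P} {t : Strat V}
    (hs : ∀ q, q ≠ p → s q ∈ D q) (ht : t ∈ D p) (q : P) : upd s p t q ∈ D q := by
  by_cases h : q = p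
  · subst h
    rwa [upd_same]
  · rw [upd_ne s t h]
    exact hs q h

lemma histOf_ne_nil {P V : Type} (A : Arena P V) (s : Profile P V) (n : ℕ) :
    histOf A s n ≠ [] := by
  cases n with
  | zero => simp [histOf]
  | succ n =>
    rw [histOf]
    split <;> simp

lemma out_mem_plays {P V : Type} (A : Arena P V) (s : Profile P V)
    (hs : ∀ p, ValidStrat A (s p)) : Out A s ∈ plays A := by
  refine ⟨by simp [Out, histOf], fun i => ?_⟩
  obtain ⟨v, h, hv⟩ := List.exists_cons_of_ne_nil (histOf_ne_nil A s i)
  have h1 : Out A s i = v := by simp [Out, hv]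
  have h2 : Out A s (i + 1) = s (A.owner v) h v := by simp [Out, histOf, hv]
  rw [h1, h2]
  exact hs _ h v

lemma posClass_finite {P V : Type} [Finite V] (A : Arena P V) : (posClass A).Finite := by
  refine (Set.finite_range fun (f : V → V) => (fun _ v => f v : Strat V)).subset ?_
  rintro s ⟨-, hs⟩
  exact ⟨s [], by funext h v; exact hs _ _ _⟩

lemma posClass_nonempty {P V : Type} (A : Arena P V) (htotal : ∀ v, ∃ u, A.edge v u) :
    (posClass A).Nonempty := by
  choose f hf using htotal
  exact ⟨fun _ v => f v, fun _ v => hf v, fun _ _ _ => rfl⟩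

lemma mem_CKop_of_forall {P W : Type} (R : P → W → W → Prop) {E : Set W} (hE : ∀ w, w ∈ E)
    (w : W) : w ∈ CKop R E := by
  obtain rfl : E = Set.univ := Set.eq_univ_of_forall hE
  have hfix : MKop R Set.univ = Set.univ := by
    simp [MKop, Kop]
  simp [CKop, Function.iterate_fixed hfix]

/-- Every strategy of `C` is weakly dominated by one in `D`, against opponents playing in `D`. -/
def Dominating {P V : Type} (A : Arena P V) (O : P → Set (ℕ → V)) (C : Set (Strat V))
    (D : P → Set (Strat V)) : Prop :=
  ∀ p, ∀ t ∈ C, ∃ t' ∈ D p, ∀ s : Profile P V, (∀ q, q ≠ p → s q ∈ D q) →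
    Out A (upd s p t) ∈ O p → Out A (upd s p t') ∈ O p

lemma exists_minimal_dominating {P V : Type} [Finite P] (A : Arena P V) (O : P → Set (ℕ → V))
    {C : Set (Strat V)} (hC : C.Finite) :
    ∃ D, Minimal (fun D : P → Set (Strat V) => (∀ p, D p ⊆ C) ∧ Dominating A O C D) D := by
  have hfin : {D : P → Set (Strat V) | ∀ p, D p ⊆ C}.Finite :=
    Set.Finite.pi' fun _ => hC.finite_subsets
  exact (hfin.subset fun D hD => hD.1 :
    {D : P → Set (Strat V) | (∀ p, D p ⊆ C) ∧ Dominating A O C D}.Finite).exists_minimal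
    ⟨fun _ => C, fun _ => subset_rfl, fun p t ht => ⟨t, ht, fun _ _ h => h⟩⟩

/-- In the model of all profiles over a minimal dominating family, in which every player knows
exactly their own strategy, everyone is rational. -/
lemma rationalIn_of_minimal {P V : Type} (A : Arena P V) (O : P → Set (ℕ → V))
    {C : Set (Strat V)} {D : P → Set (Strat V)}
    (hD : Minimal (fun D : P → Set (Strat V) => (∀ p, D p ⊆ C) ∧ Dominating A O C D) D)
    (p : P) (w : {s : Profile P V // ∀ q, s q ∈ D q}) :
    RationalIn A O C (fun p (s s' : {s : Profile P V // ∀ q, s q ∈ D q}) => s.1 p = s'.1 p)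
      Subtype.val p w := by
  rintro ⟨t, htC, hweak, w', hw', hlose, hwin⟩
  obtain ⟨t', ht'D, ht'⟩ := hD.prop.2 p t htC
  have hne : t' ≠ w.1 p := by
    rintro rfl
    have := ht' w'.1 (fun q _ => w'.2 q) hwin
    rw [hw', upd_self] at this
    exact hlose this
  set D' : P → Set (Strat V) := fun q => {u ∈ D q | q = p → u ≠ w.1 p} with hD'
  have hle : D' ≤ D := fun q u hu => hu.1
  have hdom : Dominating A O C D' := by
    intro q r hr
    obtain ⟨r', hr'D, hr'⟩ := hD.prop.2 q r hr
    by_cases hcase : q = p ∧ r' = w.1 p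
    · obtain ⟨rfl, rfl⟩ := hcase
      refine ⟨t', ⟨ht'D, fun _ => hne⟩, fun s hs hout => ?_⟩
      have hs' : ∀ q', q' ≠ q → s q' ∈ D q' := fun q' h => hle q' (hs q' h)
      have := hweak ⟨upd s q (w.1 q), upd_mem hs' hr'D⟩ (upd_same _ _ _).symm (hr' s hs' hout)
      rw [upd_upd] at this
      exact ht' s hs' this
    · exact ⟨r', ⟨hr'D, fun h h' => hcase ⟨h, h'⟩⟩,
        fun s hs => hr' s fun q' h => hle q' (hs q' h)⟩
  have := hD.le_of_le ⟨fun q => (hle q).trans (hD.prop.1 q), hdom⟩ hle p (w.2 p)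
  exact this.2 rfl rfl

lemma mem_Tchar_of_minimal {P V : Type} [Finite P] (A : Arena P V) (O : P → Set (ℕ → V))
    {C : Set (Strat V)} (hC : C.Finite) {D : P → Set (Strat V)}
    (hD : Minimal (fun D : P → Set (Strat V) => (∀ p, D p ⊆ C) ∧ Dominating A O C D) D)
    {s : Profile P V} (hs : ∀ p, s p ∈ D p) : s ∈ Tchar A O C := by
  refine ⟨
    { W := {s : Profile P V // ∀ q, s q ∈ D q}
      finW := (Set.Finite.pi' fun q => hC.subset (hD.prop.1 q)).to_subtype
      R := fun p s s' => s.1 p = s'.1 p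
      equivR := fun p => ⟨fun _ => rfl, Eq.symm, Eq.trans⟩
      σ := Subtype.val
      memC := fun w p => hD.prop.1 p (w.2 p)
      consistent := fun _ _ _ h => h }, ⟨s, hs⟩, ?_, rfl⟩
  exact mem_CKop_of_forall _ (fun w p => rationalIn_of_minimal A O hD p w) _

/-- in a two-player zero-sum game in which neither `A` (= `false`)
nor `E` (= `true`) has a positional winning strategy over positional profiles,
there is a profile `s ∈ T_{G,α,Pos}` with `out(s) ∉ O_E`. -/
theorem no_winning_gives_bad_profile {V : Type} [Fintype V] (A : Arena Bool V)
    (htotal : ∀ v, ∃ u, A.edge v u)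
    (O : Bool → Set (ℕ → V))
    (hdisj : O false ∩ O true = ∅) (hcover : O false ∪ O true = plays A)
    (hA : ¬ ∃ tA ∈ posClass A,
        ∀ s ∈ profiles A (posClass A), Out A (upd s false tA) ∈ O false)
    (hE : ¬ ∃ tE ∈ posClass A,
        ∀ s ∈ profiles A (posClass A), Out A (upd s true tE) ∈ O true) :
    ∃ s ∈ Tchar A O (posClass A), Out A s ∉ O true := by
  have hfin := posClass_finite A
  obtain ⟨D, hD⟩ := exists_minimal_dominating A O hfin
  obtain ⟨t, ht⟩ := posClass_nonempty A htotal
  obtain ⟨y, hyD, -⟩ := hD.prop.2 true t ht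
  have hyC := hD.prop.1 true hyD
  push Not at hE
  obtain ⟨s, hs, hlose⟩ := hE y hyC
  set s' := upd s true y with hs'
  have hs'C : ∀ p, s' p ∈ posClass A := upd_mem (D := fun _ => posClass A) (fun q _ => hs q) hyC
  have hwin : Out A s' ∈ O false := by
    have := out_mem_plays A s' fun p => (hs'C p).1
    rw [← hcover] at this
    exact this.resolve_right hlose
  obtain ⟨x, hxD, hx⟩ := hD.prop.2 false (s' false) (hs'C false)
  have hopp : ∀ q, q ≠ false → s' q ∈ D q := by
    intro q hq
    obtain rfl : q = true := by simpa using hq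
    rwa [hs', upd_same]
  refine ⟨upd s' false x, mem_Tchar_of_minimal A O hfin hD (upd_mem hopp hxD), fun hbad => ?_⟩
  have hgood := hx s' hopp (by rwa [upd_self])
  exact (Set.disjoint_iff_inter_eq_empty.2 hdisj).notMem_of_mem_left hgood hbad

end EpistemicRV
end
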